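/- Let n ≥ 5 and let T = (a_1, …, a_k) be a tuple of integers with k ≥ 3, a_1 = 1, a_2 = 3, 5 ≤ a_3 and a_1 < a_2 < ⋯ < a_k < n. Define h_T(x) = 1 + p_{n−2}(x+2) + ∑_{i=2}^{k} p_{a_i−2}(x+2), so that g_T(x) = x(x+1)·h_T(x). Then h_T(0) ≡ 3 (mod 4) and h_T(−1) ≡ 3 (mod 4); consequently there is no polynomial w with integer coefficients such that h_T = w². -/

import Mathlib

open Polynomial Finset

/-- For a non-negative integer `a`, the polynomial `p_a(x) = ∏_{i=0}^{a} (x + i)` over `ℤ`. -/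
noncomputable def pP (a : ℕ) : Polynomial ℤ :=
  ∏ i ∈ Finset.range (a + 1), (X + C (i : ℤ))

lemma pP_split (b : ℕ) : pP (b + 2) = X * (X + 1) * (pP b).comp (X + C 2) := by
  unfold pP
  rw [Polynomial.prod_comp, Finset.prod_range_succ', Finset.prod_range_succ']
  have : ∏ i ∈ Finset.range (b + 1), (X + C ((i : ℤ))).comp (X + C 2)
      = ∏ i ∈ Finset.range (b + 1), (X + C (((i + 1 + 1 : ℕ) : ℤ)) : Polynomial ℤ) := by
    refine Finset.prod_congr rfl fun i _ => ?_
    simp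
    ring
  rw [this]
  simp
  ring

lemma pP_eval_dvd (b : ℕ) (hb : 3 ≤ b) (x : ℤ) (hx : x = 0 ∨ x = -1) :
    (4 : ℤ) ∣ ((pP b).comp (X + C 2)).eval x := by
  unfold pP
  rw [Polynomial.prod_comp, Polynomial.eval_prod]
  rcases hx with rfl | rfl
  · refine dvd_trans ?_ (Finset.dvd_prod_of_mem _ (Finset.mem_range.2 (by omega : 2 < b + 1)))
    simp
  · refine dvd_trans ?_ (Finset.dvd_prod_of_mem _ (Finset.mem_range.2 (by omega : 3 < b + 1)))
    simp

/-- Let `n ≥ 5` and `T = (a_1, …, a_k)` with `k ≥ 3`, `a_1 = 1`, `a_2 = 3`, `5 ≤ a_3`,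
`a_1 < a_2 < ⋯ < a_k < n`.  With
`h_T(x) = 1 + p_{n-2}(x+2) + ∑_{i=2}^{k} p_{a_i - 2}(x+2)` one has
`g_T(x) = x(x+1) h_T(x)`, `h_T(0) ≡ 3 (mod 4)`, `h_T(-1) ≡ 3 (mod 4)`, and consequently `h_T` is
not the square of a polynomial with integer coefficients. -/
theorem statement3 (n k : ℕ) (a : ℕ → ℕ) (hn : 5 ≤ n) (hk : 3 ≤ k)
    (ha1 : a 0 = 1) (ha2 : a 1 = 3) (ha3 : 5 ≤ a 2)
    (hmono : ∀ i j, i < j → j < k → a i < a j)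
    (hlt : ∀ i, i < k → a i < n)
    (g h : Polynomial ℤ)
    (hg : g = pP n + ∑ i ∈ Finset.range k, pP (a i))
    (hh : h = 1 + (pP (n - 2)).comp (X + C 2) +
        ∑ i ∈ Finset.Ico 1 k, (pP (a i - 2)).comp (X + C 2)) :
    g = X * (X + 1) * h ∧ h.eval 0 % 4 = 3 ∧ h.eval (-1) % 4 = 3 ∧
      ¬ ∃ w : Polynomial ℤ, h = w ^ 2 := by
  have hge : ∀ i, 2 ≤ i → i < k → 5 ≤ a i := by
    intro i hi hik
    rcases Nat.lt_or_ge 2 i with h2 | h2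
    · have := hmono 2 i h2 hik
      omega
    · have : i = 2 := by omega
      subst this
      exact ha3
  have hp1 : pP 1 = X * (X + 1) := by
    simp [pP, Finset.prod_range_succ]
  have key : ∀ x : ℤ, x = 0 ∨ x = -1 → h.eval x % 4 = 3 := by
    intro x hx
    have h1 := pP_eval_dvd (n - 2) (by omega) x hx
    have h2 : (4 : ℤ) ∣ ∑ i ∈ Finset.Ico 2 k, ((pP (a i - 2)).comp (X + C 2)).eval x := by
      refine Finset.dvd_sum fun i hi => ?_
      rw [Finset.mem_Ico] at hi
      have := hge i hi.1 hi.2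
      exact pP_eval_dvd (a i - 2) (by omega) x hx
    have h3 : ((pP (a 1 - 2)).comp (X + C 2)).eval x % 4 = 2 := by
      rw [ha2]
      change ((pP 1).comp (X + C 2)).eval x % 4 = 2
      rw [hp1]
      rcases hx with rfl | rfl <;> simp
    rw [hh, Finset.sum_eq_sum_Ico_succ_bot (by omega : 1 < k)]
    simp only [Polynomial.eval_add, Polynomial.eval_finset_sum, Polynomial.eval_one]
    simp only [Nat.reduceAdd]
    omega
  refine ⟨?_, key 0 (Or.inl rfl), key (-1) (Or.inr rfl), ?_⟩
  · have hs : ∀ m, 2 ≤ m → pP m = X * (X + 1) * (pP (m - 2)).comp (X + C 2) := by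
      intro m hm
      obtain ⟨b, rfl⟩ := Nat.exists_eq_add_of_le' hm
      simpa using pP_split b
    have hsum : ∑ i ∈ Finset.Ico 1 k, pP (a i)
        = X * (X + 1) * ∑ i ∈ Finset.Ico 1 k, (pP (a i - 2)).comp (X + C 2) := by
      rw [Finset.mul_sum]
      refine Finset.sum_congr rfl fun i hi => hs _ ?_
      rw [Finset.mem_Ico] at hi
      have := hmono 0 i (by omega) hi.2
      omega
    rw [hg, hh, Finset.range_eq_Ico, Finset.sum_eq_sum_Ico_succ_bot (by omega : 0 < k), ha1, hp1,
      hs n (by omega)]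
    simp only [Nat.zero_add]
    rw [hsum]
    ring
  · rintro ⟨w, hw⟩
    have h0 := key 0 (Or.inl rfl)
    rw [hw, Polynomial.eval_pow] at h0
    generalize w.eval 0 = y at h0
    rcases Int.even_or_odd' y with ⟨c, rfl | rfl⟩ <;> ring_nf at h0 <;> omega
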